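/- arXiv:2205.02949 — 4 statements merged into one kernel-verified Lean document; each statement's English description precedes it below -/
import Mathlib

section
/- Let (Ω, μ) be a probability space, E a real inner product space, and v_1, ..., v_N : Ω → E random vectors such that v_i is square-integrable for every i outside a set S ⊆ {1,...,N} with |S| = B and 2B < N. Set R = N - B, α = B/N, C_α = (2-2α)/(1-2α), and let v̄ = (1/R) ∑_{i ∉ S} E[v_i]. Let Z : Ω → E be measurable such that for μ-almost every ω, Z(ω) minimizes w ↦ ∑_{i=1}^N ‖w - v_i(ω)‖ over E. Then E‖Z - v̄‖² ≤ (C_α² / R) ∑_{i ∉ S} E‖v_i - E[v_i]‖² + (C_α² / R) ∑_{i ∉ S} ‖E[v_i] - v̄‖². -/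
open Finset MeasureTheory


lemma bias_variance {Ω : Type*} [MeasurableSpace Ω] (μ : Measure Ω) [IsProbabilityMeasure μ]
    {E : Type*} [NormedAddCommGroup E] [InnerProductSpace ℝ E] [CompleteSpace E]
    (f : Ω → E) (hf : MemLp f 2 μ) (c : E) :
    ∫ ω, ‖f ω - c‖ ^ 2 ∂μ = ∫ ω, ‖f ω - ∫ ω', f ω' ∂μ‖ ^ 2 ∂μ + ‖(∫ ω, f ω ∂μ) - c‖ ^ 2 := by
  set m := ∫ ω, f ω ∂μ with hm
  have hfi : Integrable f μ := hf.integrable (by norm_num)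
  have h1 : Integrable (fun ω => ‖f ω - m‖ ^ 2) μ :=
    (hf.sub (memLp_const m)).integrable_norm_pow (by norm_num)
  have hfm : Integrable (fun ω => f ω - m) μ := hfi.sub (integrable_const m)
  have h2 : Integrable (fun ω => inner ℝ (m - c) (f ω - m)) μ := hfm.const_inner _
  have h3 : ∫ ω, inner ℝ (m - c) (f ω - m) ∂μ = 0 := by
    rw [integral_inner hfm, integral_sub hfi (integrable_const m)]
    simp [← hm]
  have h4 : ∀ ω, ‖f ω - c‖ ^ 2 = ‖f ω - m‖ ^ 2 + (2 * inner ℝ (m - c) (f ω - m) + ‖m - c‖ ^ 2) := by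
    intro ω
    have : f ω - c = (f ω - m) + (m - c) := by abel
    rw [this, norm_add_sq_real, real_inner_comm]
    ring
  have h5 : Integrable (fun ω => 2 * inner ℝ (m - c) (f ω - m) + ‖m - c‖ ^ 2) μ :=
    (h2.const_mul 2).add (integrable_const _)
  simp_rw [h4]
  rw [integral_add h1 h5,
    integral_add (h2.const_mul 2) (integrable_const _), integral_const_mul, h3]
  simp

lemma median_bound {E : Type*} [NormedAddCommGroup E] (N : ℕ) (x : Fin N → E)
    (S : Finset (Fin N)) (z c : E)
    (h : ∑ i, ‖z - x i‖ ≤ ∑ i, ‖c - x i‖) :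
    ((N : ℝ) - 2 * S.card) * ‖z - c‖ ≤ 2 * ∑ i ∈ Sᶜ, ‖x i - c‖ := by
  rw [← Finset.sum_add_sum_compl S, ← Finset.sum_add_sum_compl S] at h
  have h1 : ∑ i ∈ S, ‖c - x i‖ ≤ ∑ i ∈ S, (‖z - x i‖ + ‖z - c‖) := by
    refine Finset.sum_le_sum fun i _ => ?_
    have := norm_sub_le_norm_sub_add_norm_sub c z (x i)
    rw [norm_sub_rev c z] at this
    linarith
  have h2 : ∑ i ∈ Sᶜ, ‖z - c‖ ≤ ∑ i ∈ Sᶜ, (‖z - x i‖ + ‖x i - c‖) :=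
    Finset.sum_le_sum fun i _ => norm_sub_le_norm_sub_add_norm_sub z (x i) c
  have h3 : ∑ i ∈ Sᶜ, ‖c - x i‖ = ∑ i ∈ Sᶜ, ‖x i - c‖ :=
    Finset.sum_congr rfl fun i _ => norm_sub_rev _ _
  have h5 : ((Sᶜ.card : ℕ) : ℝ) = N - S.card := by
    rw [Finset.card_compl, Fintype.card_fin, Nat.cast_sub]
    simpa using Finset.card_le_univ S
  rw [Finset.sum_add_distrib, Finset.sum_const, nsmul_eq_mul] at h1 h2
  rw [h5] at h2
  linarith

/-- Lemma 1 of the paper: mean-squared error of the geometric median relative to the mean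
of the uncontaminated random vectors. -/
theorem stmt_4 {Ω : Type*} [MeasurableSpace Ω] (μ : Measure Ω) [IsProbabilityMeasure μ]
    {E : Type*} [NormedAddCommGroup E] [InnerProductSpace ℝ E] [CompleteSpace E]
    [MeasurableSpace E] [BorelSpace E]
    (N B : ℕ) (v : Fin N → Ω → E) (S : Finset (Fin N))
    (hScard : S.card = B) (hB : 2 * B < N)
    (hv : ∀ i ∉ S, MemLp (v i) 2 μ)
    (vbar : E) (hvbar : vbar = (1 / ((N : ℝ) - B)) • ∑ i ∈ Sᶜ, ∫ ω, v i ω ∂μ)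
    (Z : Ω → E) (hZmeas : Measurable Z)
    (hZ : ∀ᵐ ω ∂μ, ∀ w : E, ∑ i, ‖Z ω - v i ω‖ ≤ ∑ i, ‖w - v i ω‖) :
    ∫ ω, ‖Z ω - vbar‖ ^ 2 ∂μ ≤
      (((2 - 2 * ((B : ℝ) / N)) / (1 - 2 * ((B : ℝ) / N))) ^ 2 / ((N : ℝ) - B)) *
        ∑ i ∈ Sᶜ, ∫ ω, ‖v i ω - ∫ ω', v i ω' ∂μ‖ ^ 2 ∂μ +
      (((2 - 2 * ((B : ℝ) / N)) / (1 - 2 * ((B : ℝ) / N))) ^ 2 / ((N : ℝ) - B)) *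
        ∑ i ∈ Sᶜ, ‖(∫ ω, v i ω ∂μ) - vbar‖ ^ 2 := by
  have hNB : (0 : ℝ) < N - 2 * B := by
    have : ((2 * B : ℕ) : ℝ) < N := by exact_mod_cast hB
    push_cast at this
    linarith
  have hB0 : (0 : ℝ) ≤ B := Nat.cast_nonneg B
  have hR : (0 : ℝ) < N - B := by linarith
  have hN : (0 : ℝ) < N := by linarith
  have hC : (2 - 2 * ((B : ℝ) / N)) / (1 - 2 * ((B : ℝ) / N)) = 2 * (N - B) / (N - 2 * B) := by
    have h1 : 2 - 2 * ((B : ℝ) / N) = 2 * (N - B) / N := by field_simp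
    have h2 : 1 - 2 * ((B : ℝ) / N) = (N - 2 * B) / N := by field_simp
    rw [h1, h2, div_div_div_cancel_right₀ hN.ne']
  rw [hC]
  set K : ℝ := (2 * ((N : ℝ) - B) / (N - 2 * B)) ^ 2 / (N - B) with hK
  have hcard : ((Sᶜ.card : ℕ) : ℝ) = N - B := by
    rw [Finset.card_compl, Fintype.card_fin, hScard, Nat.cast_sub (by omega)]
  have hint : ∀ i ∈ Sᶜ, Integrable (fun ω => ‖v i ω - vbar‖ ^ 2) μ := fun i hi =>
    ((hv i (Finset.mem_compl.mp hi)).sub (memLp_const vbar)).integrable_norm_pow (by norm_num)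
  have key : ∀ᵐ ω ∂μ, ‖Z ω - vbar‖ ^ 2 ≤ K * ∑ i ∈ Sᶜ, ‖v i ω - vbar‖ ^ 2 := by
    filter_upwards [hZ] with ω hω
    have h1 := median_bound N (fun i => v i ω) S (Z ω) vbar (hω vbar)
    rw [hScard] at h1
    have h2 := sq_sum_le_card_mul_sum_sq (s := Sᶜ) (f := fun i => ‖v i ω - vbar‖)
    rw [hcard] at h2
    have h3 := pow_le_pow_left₀ (by positivity) h1 2
    have h4 : K = 4 * (N - B) / (N - 2 * B) ^ 2 := by
      rw [hK]; field_simp; ring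
    rw [h4, div_mul_eq_mul_div, le_div_iff₀ (by positivity)]
    nlinarith
  calc ∫ ω, ‖Z ω - vbar‖ ^ 2 ∂μ ≤ ∫ ω, K * ∑ i ∈ Sᶜ, ‖v i ω - vbar‖ ^ 2 ∂μ :=
        integral_mono_of_nonneg (Filter.Eventually.of_forall fun ω => by positivity)
          ((integrable_finsetSum _ hint).const_mul K) key
    _ = K * ∑ i ∈ Sᶜ, ∫ ω, ‖v i ω - vbar‖ ^ 2 ∂μ := by
        rw [integral_const_mul, integral_finsetSum _ hint]
    _ = _ := by
        rw [← mul_add, ← Finset.sum_add_distrib]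
        congr 1
        exact Finset.sum_congr rfl fun i hi =>
          bias_variance μ (v i) (hv i (Finset.mem_compl.mp hi)) vbar
end

section
/- Let E be a real inner product space, let μ, L > 0, and let g : E → E satisfy (i) strong monotonicity: ⟨g(x) - g(y), x - y⟩ ≥ μ‖x - y‖² for all x, y, and (ii) Lipschitz continuity: ‖g(x) - g(y)‖ ≤ L‖x - y‖ for all x, y. Let w* ∈ E with g(w*) = 0, and let η > 0 satisfy η ≤ μ/(2L²) and η < 2/μ. Then for all w, w' ∈ E: ‖w' - w*‖² ≤ (1 - ημ)‖w - w*‖² + (2/(ημ)) ‖w' - w + η g(w)‖². -/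
/-- One-step contraction inequality (equation (10) in the proof of Theorem 1). -/
theorem stmt_5 {E : Type*} [NormedAddCommGroup E] [InnerProductSpace ℝ E]
    (μ L : ℝ) (hμ : 0 < μ) (hL : 0 < L) (g : E → E)
    (hmono : ∀ x y : E, μ * ‖x - y‖ ^ 2 ≤ (inner ℝ (g x - g y) (x - y) : ℝ))
    (hlip : ∀ x y : E, ‖g x - g y‖ ≤ L * ‖x - y‖)
    (wstar : E) (hstar : g wstar = 0)
    (η : ℝ) (hη : 0 < η) (hη1 : η ≤ μ / (2 * L ^ 2)) (hη2 : η < 2 / μ) :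
    ∀ w w' : E, ‖w' - wstar‖ ^ 2 ≤
      (1 - η * μ) * ‖w - wstar‖ ^ 2 + (2 / (η * μ)) * ‖w' - w + η • g w‖ ^ 2 := by
  intro w w'
  have hm := hmono w wstar
  have hl := hlip w wstar
  rw [hstar, sub_zero] at hm hl
  set d := w - wstar with hd
  set e := w' - w + η • g w with he
  have hw : w' - wstar = (d - η • g w) + e := by rw [hd, he]; abel
  have hG : ‖g w‖ ^ 2 ≤ L ^ 2 * ‖d‖ ^ 2 := by
    rw [← mul_pow]; exact pow_le_pow_left₀ (norm_nonneg _) hl 2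
  have hηL : η * (2 * L ^ 2) ≤ μ := (le_div_iff₀ (by positivity)).1 hη1
  have ht2 : η * μ < 2 := (lt_div_iff₀ hμ).1 hη2
  have ht : 0 < η * μ := mul_pos hη hμ
  have hA : ‖d - η • g w‖ ^ 2 ≤ (1 - 3 / 2 * (η * μ)) * ‖d‖ ^ 2 := by
    rw [norm_sub_sq_real, inner_smul_right, norm_smul, mul_pow, Real.norm_eq_abs, sq_abs,
      real_inner_comm]
    have h1 := mul_le_mul_of_nonneg_left hm hη.le
    have h2 := mul_le_mul_of_nonneg_left hG (sq_nonneg η)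
    have h3 := mul_le_mul_of_nonneg_left hηL (mul_nonneg hη.le (sq_nonneg ‖d‖))
    linarith
  rw [hw]
  generalize d - η • g w = a at hA
  generalize η * μ = t at *
  have hs : 0 < 2 - t := by linarith
  have hq : 0 ≤ ‖t • a - (2 - t) • e‖ ^ 2 := sq_nonneg _
  rw [norm_sub_sq_real, inner_smul_right, real_inner_smul_left, norm_smul, norm_smul, mul_pow,
    mul_pow, Real.norm_eq_abs, sq_abs, Real.norm_eq_abs, sq_abs] at hq
  rw [norm_add_sq_real]
  have hkey : t * (2 - t) * (‖a‖ ^ 2 + 2 * inner ℝ a e + ‖e‖ ^ 2)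
      ≤ t * (2 - t) * ((1 - t) * ‖d‖ ^ 2 + 2 / t * ‖e‖ ^ 2) := by
    have h4 : t * (2 - t) * ((1 - t) * ‖d‖ ^ 2 + 2 / t * ‖e‖ ^ 2)
      = t * (2 - t) * (1 - t) * ‖d‖ ^ 2 + 2 * (2 - t) * ‖e‖ ^ 2 := by
      field_simp
    rw [h4]
    have h5 := mul_le_mul_of_nonneg_left hA ht.le
    have h6 : 0 ≤ t ^ 3 * ‖d‖ ^ 2 := by positivity
    linarith
  exact le_of_mul_le_mul_left hkey (mul_pos ht hs)
end

section
/- Let E be a real inner product space, let μ, L > 0, and let g : E → E satisfy ⟨g(x) - g(y), x - y⟩ ≥ μ‖x - y‖² and ‖g(x) - g(y)‖ ≤ L‖x - y‖ for all x, y ∈ E. Let w* ∈ E with g(w*) = 0, let η > 0 satisfy η ≤ μ/(2L²) and η < 2/μ, let V ≥ 0, and let (w_t)_{t∈ℕ} be a sequence in E such that ‖w_{t+1} - w_t + η g(w_t)‖² ≤ η² V for all t. Then for all t ∈ ℕ: ‖w_t - w*‖² ≤ (1 - ημ)^t (‖w_0 - w*‖² - A) + A, where A = 2V/μ². -/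
/-- Convergence claim of Theorem 1: linear convergence at rate `1 - ημ` to a neighborhood
of the optimum with asymptotic error `2V/μ²`. -/
theorem stmt_10 {E : Type*} [NormedAddCommGroup E] [InnerProductSpace ℝ E]
    (μ L : ℝ) (hμ : 0 < μ) (hL : 0 < L) (g : E → E)
    (hmono : ∀ x y : E, μ * ‖x - y‖ ^ 2 ≤ (inner ℝ (g x - g y) (x - y) : ℝ))
    (hlip : ∀ x y : E, ‖g x - g y‖ ≤ L * ‖x - y‖)
    (wstar : E) (hstar : g wstar = 0)
    (η : ℝ) (hη : 0 < η) (hη1 : η ≤ μ / (2 * L ^ 2)) (hη2 : η < 2 / μ)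
    (V : ℝ) (hV : 0 ≤ V) (w : ℕ → E)
    (hstep : ∀ t : ℕ, ‖w (t + 1) - w t + η • g (w t)‖ ^ 2 ≤ η ^ 2 * V) :
    ∀ t : ℕ, ‖w t - wstar‖ ^ 2 ≤
      (1 - η * μ) ^ t * (‖w 0 - wstar‖ ^ 2 - 2 * V / μ ^ 2) + 2 * V / μ ^ 2 := by
  have hA : 0 ≤ 2 * V / μ ^ 2 := by positivity
  have hx : 0 < η * μ := by positivity
  have hx2 : η * μ < 2 := (lt_div_iff₀ hμ).1 hη2
  have hηL : η * (2 * L ^ 2) ≤ μ := (le_div_iff₀ (by positivity)).1 hη1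
  by_cases hE : ∀ x : E, ‖x‖ = 0
  · intro t
    rw [hE, hE]
    have h1 : (1 - η * μ) ^ t ≤ 1 := by
      refine (le_abs_self _).trans ?_
      rw [abs_pow]
      exact pow_le_one₀ (abs_nonneg _) (abs_le.2 ⟨by linarith, by linarith⟩)
    nlinarith
  · push Not at hE
    obtain ⟨x, hx0⟩ := hE
    have hxp : 0 < ‖x‖ := lt_of_le_of_ne (norm_nonneg _) (Ne.symm hx0)
    have hμL : μ ≤ L := by
      have h1 := hmono x 0
      have h2 := hlip x 0
      have h3 := real_inner_le_norm (g x - g 0) (x - 0)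
      rw [sub_zero] at h1 h2 h3
      have h4 : μ * ‖x‖ ^ 2 ≤ L * ‖x‖ ^ 2 := by nlinarith
      exact le_of_mul_le_mul_right h4 (by positivity)
    have hhalf : η * μ ≤ 1 / 2 := by
      have h1 : η * (2 * (μ * μ)) ≤ η * (2 * L ^ 2) := by
        apply mul_le_mul_of_nonneg_left _ hη.le
        nlinarith
      have h2 : (2 * (η * μ)) * μ ≤ 1 * μ := by linarith
      have := le_of_mul_le_mul_right h2 hμ
      linarith
    have key : ∀ t, ‖w (t + 1) - wstar‖ ^ 2 ≤
        (1 - η * μ) * ‖w t - wstar‖ ^ 2 + η * μ * (2 * V / μ ^ 2) := by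
      intro t
      have hs := hstep t
      have hm := hmono (w t) wstar
      have hl := hlip (w t) wstar
      rw [hstar, sub_zero] at hm hl
      set d := w t - wstar with hd
      set G := g (w t) with hG
      set e := w (t + 1) - w t + η • G with he
      have hdec : w (t + 1) - wstar = (d - η • G) + e := by
        rw [hd, he]; abel
      have hu : ‖d - η • G‖ ^ 2 ≤ (1 - 3 / 2 * (η * μ)) * ‖d‖ ^ 2 := by
        rw [norm_sub_sq_real, norm_smul, real_inner_smul_right, real_inner_comm,
          Real.norm_eq_abs, mul_pow, sq_abs]
        have h1 : ‖G‖ ^ 2 ≤ L ^ 2 * ‖d‖ ^ 2 := by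
          rw [← mul_pow]; exact pow_le_pow_left₀ (norm_nonneg _) hl 2
        have h2 : η ^ 2 * ‖G‖ ^ 2 ≤ η ^ 2 * (L ^ 2 * ‖d‖ ^ 2) :=
          mul_le_mul_of_nonneg_left h1 (by positivity)
        have h3 : (η * (2 * L ^ 2)) * (η * ‖d‖ ^ 2) ≤ μ * (η * ‖d‖ ^ 2) :=
          mul_le_mul_of_nonneg_right hηL (by positivity)
        have h4 := mul_le_mul_of_nonneg_left hm hη.le
        linarith
      have hn : ‖w (t + 1) - wstar‖ ≤ ‖d - η • G‖ + ‖e‖ := by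
        rw [hdec]; exact norm_add_le _ _
      have hn2 := pow_le_pow_left₀ (norm_nonneg _) hn 2
      refine hn2.trans ?_
      have hV' : η ^ 2 * V = (η * μ) ^ 2 * (V / μ ^ 2) := by field_simp
      rw [hV'] at hs
      rw [mul_div_assoc]
      have hB : 0 ≤ V / μ ^ 2 := by positivity
      generalize V / μ ^ 2 = B at *
      generalize ‖d - η • G‖ = U at *
      generalize ‖e‖ = ε at *
      generalize ‖d‖ ^ 2 = D at *
      generalize η * μ = y at *
      have ha : 0 < 2 - 3 * y := by linarith
      have hY : (2 - 3 * y) * y * (U + ε) ^ 2 ≤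
          (2 - 3 * y) * y * ((1 - y) * D + y * (2 * B)) := by
        have q := sq_nonneg (y * U - (2 - 3 * y) * ε)
        have c1 : 0 ≤ (2 - 2 * y) * y := mul_nonneg (by linarith) hx.le
        have c2 : 0 ≤ (2 - 3 * y) * (2 - 2 * y) := mul_nonneg ha.le (by linarith)
        have p1 := mul_le_mul_of_nonneg_left hu c1
        have p2 := mul_le_mul_of_nonneg_left hs c2
        have p3 : 0 ≤ (2 - 3 * y) * y ^ 3 * B := by positivity
        linarith
      exact le_of_mul_le_mul_left hY (by positivity)
    intro t
    induction t with
    | zero => simp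
    | succ t ih =>
      have h1 := mul_le_mul_of_nonneg_left ih (by linarith : 0 ≤ 1 - η * μ)
      have h2 := key t
      rw [pow_succ (1 - η * μ) t]
      generalize 2 * V / μ ^ 2 = A at *
      linarith
end

section
/- Let (Ω, μ) be a probability space, p a positive integer, and v_1, ..., v_R : Ω → ℝ^p independent, square-integrable random vectors. Let S = (1/R) ∑_{g=1}^R v_g and v̄ = (1/R) ∑_{g=1}^R E[v_g]. Then ∑_{k=1}^R E‖v_k - S‖² = (1 - 1/R) ∑_{k=1}^R E‖v_k - E[v_k]‖² + ∑_{k=1}^R ‖E[v_k] - v̄‖². -/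
open Finset MeasureTheory ProbabilityTheory

lemma alg_aux {E : Type*} [NormedAddCommGroup E] [InnerProductSpace ℝ E] (R : ℕ) (hR : 0 < R)
    (a : Fin R → E) :
    ∑ k, ‖a k - (1 / (R : ℝ)) • ∑ g, a g‖ ^ 2 =
      ∑ k, ‖a k‖ ^ 2 - (1 / (R : ℝ)) * ∑ g, ∑ h, inner ℝ (a g) (a h) := by
  have hR' : (R : ℝ) ≠ 0 := by positivity
  have h1 : ∑ g, ∑ h, inner ℝ (a g) (a h) = ‖∑ g, a g‖ ^ 2 := by
    rw [← real_inner_self_eq_norm_sq, sum_inner]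
    simp_rw [inner_sum]
  have h2 : ∑ k, inner ℝ (a k) (∑ g, a g) = ‖∑ g, a g‖ ^ 2 := by
    rw [← real_inner_self_eq_norm_sq, sum_inner]
  rw [h1]
  simp_rw [norm_sub_sq_real, inner_smul_right, norm_smul, mul_pow]
  rw [sum_add_distrib, sum_sub_distrib, ← mul_sum, ← mul_sum, h2]
  simp
  field_simp
  ring

/-- Bias–variance decomposition of the total squared deviation from the empirical mean
(equations (31)–(35) in the proof of Lemma 4). -/
theorem stmt_12 {Ω : Type*} [MeasurableSpace Ω] (μ : Measure Ω) [IsProbabilityMeasure μ]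
    (p R : ℕ) (hp : 0 < p) (hR : 0 < R)
    (v : Fin R → Ω → EuclideanSpace ℝ (Fin p))
    (hmem : ∀ g, MemLp (v g) 2 μ)
    (hindep : iIndepFun v μ) :
    ∑ k, ∫ ω, ‖v k ω - (1 / (R : ℝ)) • ∑ g, v g ω‖ ^ 2 ∂μ =
      (1 - 1 / (R : ℝ)) * ∑ k, ∫ ω, ‖v k ω - ∫ ω', v k ω' ∂μ‖ ^ 2 ∂μ +
        ∑ k, ‖(∫ ω, v k ω ∂μ) - (1 / (R : ℝ)) • ∑ g, ∫ ω, v g ω ∂μ‖ ^ 2 := by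
  have hint : ∀ g, Integrable (v g) μ := fun g => (hmem g).integrable (by norm_num)
  have hsq : ∀ {f : Ω → EuclideanSpace ℝ (Fin p)}, MemLp f 2 μ →
      Integrable (fun ω => ‖f ω‖ ^ 2) μ := fun hf => hf.integrable_norm_pow (by norm_num)
  have hinn : ∀ g h, Integrable (fun ω => inner ℝ (v g ω) (v h ω)) μ := by
    intro g h
    have h1 := (((hsq ((hmem g).add (hmem h))).sub (hsq (hmem g))).sub
      (hsq (hmem h))).div_const 2
    refine h1.congr (Filter.Eventually.of_forall fun ω => ?_)
    simp only [Pi.sub_apply, Pi.add_apply]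
    rw [norm_add_sq_real]
    ring
  have hmean : MemLp (fun ω => (1 / (R : ℝ)) • ∑ g, v g ω) 2 μ :=
    (memLp_finsetSum univ fun g _ => hmem g).const_smul (1 / (R : ℝ))
  have hvar : ∀ k, ∫ ω, ‖v k ω - ∫ ω', v k ω' ∂μ‖ ^ 2 ∂μ
      = ∫ ω, ‖v k ω‖ ^ 2 ∂μ - ‖∫ ω, v k ω ∂μ‖ ^ 2 := by
    intro k
    have hc : Integrable (fun ω => inner ℝ (v k ω) (∫ ω', v k ω' ∂μ)) μ :=
      (hint k).inner_const _
    have hs : Integrable (fun ω => ‖v k ω‖ ^ 2 - 2 * inner ℝ (v k ω) (∫ ω', v k ω' ∂μ)) μ :=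
      (hsq (hmem k)).sub (hc.const_mul 2)
    have he : ∫ ω, inner ℝ (v k ω) (∫ ω', v k ω' ∂μ) ∂μ = ‖∫ ω, v k ω ∂μ‖ ^ 2 := by
      rw [← real_inner_self_eq_norm_sq, ← integral_inner (hint k)]
      exact integral_congr_ae (Filter.Eventually.of_forall fun ω => real_inner_comm _ _)
    simp_rw [norm_sub_sq_real]
    rw [integral_add hs (integrable_const _),
      integral_sub (hsq (hmem k)) (hc.const_mul 2), integral_const_mul, he]
    simp
    ring
  have hcross : ∀ g h, ∫ ω, inner ℝ (v g ω) (v h ω) ∂μ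
      = inner ℝ (∫ ω, v g ω ∂μ) (∫ ω, v h ω ∂μ) +
        if g = h then ∫ ω, ‖v g ω - ∫ ω', v g ω' ∂μ‖ ^ 2 ∂μ else 0 := by
    intro g h
    split_ifs with hgh
    · subst hgh
      rw [hvar]
      simp_rw [real_inner_self_eq_norm_sq]
      ring
    · rw [add_zero]
      exact (hindep.indepFun hgh).integral_bilin (hint g) (hint h) (innerSL ℝ)
  have hd : ∀ k, Integrable (fun ω => ‖v k ω - (1 / (R : ℝ)) • ∑ g, v g ω‖ ^ 2) μ :=
    fun k => hsq ((hmem k).sub hmean)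
  rw [← integral_finsetSum _ fun k _ => hd k]
  simp_rw [alg_aux R hR]
  rw [integral_sub (integrable_finsetSum _ fun k _ => hsq (hmem k))
    ((integrable_finsetSum _ fun g _ => integrable_finsetSum _ fun h _ => hinn g h).const_mul _),
    integral_const_mul, integral_finsetSum _ fun k _ => hsq (hmem k),
    integral_finsetSum _ fun g _ => integrable_finsetSum _ fun h _ => hinn g h]
  simp_rw [integral_finsetSum _ fun h _ => hinn _ h, hcross, sum_add_distrib, sum_ite_eq,
    mem_univ, if_true, hvar, sum_sub_distrib]
  ring
end
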